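/- If n = (n₁,…,n_m) ∈ ℤ₊^m(⊛;p₁,…,p_m), then for each k = 1,…,m and ν = 0,…,n_k − deg(p_{k+1}⋯p_m) − 1, one has ∫ x^ν Q̃_n(x) (p₁⋯p_m)(x) ds_k(x) = 0. -/

import Mathlib

open MeasureTheory Polynomial Filter Set Metric

/-- The (closed) support of a Borel measure on `ℝ`. -/
def msupport (μ : MeasureTheory.Measure ℝ) : Set ℝ :=
  {x | ∀ ε > 0, 0 < μ (Metric.ball x ε)}

/-- The smallest closed interval containing the support of `μ`. -/
noncomputable def ihull (μ : MeasureTheory.Measure ℝ) : Set ℝ :=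
  Set.Icc (sInf (msupport μ)) (sSup (msupport μ))

/-- The support of a measure viewed inside `ℂ`. -/
def csupp (μ : MeasureTheory.Measure ℝ) : Set ℂ :=
  Complex.ofReal '' msupport μ

/-- Density (with respect to `μ a`) of the Nikishin measure
`⟨w_a μ_a, w_{a+1} μ_{a+1}, …, w_{a+r} μ_{a+r}⟩`:  for `r = 0` it is just the weight `w a`,
and inductively it is `w a` times the Cauchy transform of the inner system. -/
noncomputable def nikD (μ : ℕ → MeasureTheory.Measure ℝ) (w : ℕ → ℝ → ℂ) : ℕ → ℕ → ℝ → ℂ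
  | a, 0 => w a
  | a, r + 1 => fun x =>
      w a x * ∫ t, nikD μ w (a + 1) r t / ((x : ℂ) - (t : ℂ)) ∂(μ (a + 1))

/-- Integral of `f` against the `k`-th measure (0-indexed) of the Nikishin system generated
by the weighted measures `w_j μ_j`. -/
noncomputable def nikInt (μ : ℕ → MeasureTheory.Measure ℝ) (w : ℕ → ℝ → ℂ) (k : ℕ)
    (f : ℝ → ℂ) : ℂ :=
  ∫ x, f x * nikD μ w 0 k x ∂(μ 0)

/-- The multiple orthogonality relations for the multi-index `n` (0-indexed). -/
def OrthRel (μ : ℕ → MeasureTheory.Measure ℝ) (w : ℕ → ℝ → ℂ) (m : ℕ) (n : ℕ → ℕ)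
    (Q : Polynomial ℂ) : Prop :=
  ∀ k < m, ∀ ν < n k, nikInt μ w k (fun x => (x : ℂ) ^ ν * Q.eval (x : ℂ)) = 0

/-- `Q` is a monic multiple orthogonal polynomial of smallest degree for the Nikishin system
generated by the weighted measures `w_j μ_j` and the multi-index `n`. -/
def IsLeastMOP (μ : ℕ → MeasureTheory.Measure ℝ) (w : ℕ → ℝ → ℂ) (m : ℕ) (n : ℕ → ℕ)
    (Q : Polynomial ℂ) : Prop :=
  Q.Monic ∧ OrthRel μ w m n Q ∧
    ∀ Q' : Polynomial ℂ, Q'.Monic → OrthRel μ w m n Q' → Q.natDegree ≤ Q'.natDegree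

/-- The second type functions: `psiFun μ w Q 0 = Q` and
`psiFun μ w Q (k+1) z = ∫ psiFun μ w Q k (x) · w k x / (z - x) dμ_k(x)`. -/
noncomputable def psiFun (μ : ℕ → MeasureTheory.Measure ℝ) (w : ℕ → ℝ → ℂ)
    (Q : Polynomial ℂ) : ℕ → ℂ → ℂ
  | 0 => fun z => Q.eval z
  | k + 1 => fun z => ∫ x, psiFun μ w Q k (x : ℂ) * w k x / (z - (x : ℂ)) ∂(μ k)

/-- A system of `m` finite Borel measures with compact support on `ℝ`, each of constant
sign (`ς k ∈ {1,-1}`), whose interval hulls `Δ_k` are consecutively disjoint: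
the generator of a Nikishin system. -/
structure NikSys (m : ℕ) where
  μ : ℕ → MeasureTheory.Measure ℝ
  ς : ℕ → ℝ
  hsign : ∀ k < m, ς k = 1 ∨ ς k = -1
  hfin : ∀ k < m, MeasureTheory.IsFiniteMeasure (μ k)
  hcpt : ∀ k < m, IsCompact (msupport (μ k))
  hne : ∀ k < m, (msupport (μ k)).Nonempty
  hdisj : ∀ k, k + 1 < m → ihull (μ k) ∩ ihull (μ (k + 1)) = ∅

/-- The weights of the unperturbed system: just the signs. -/
def NikSys.w {m : ℕ} (S : NikSys m) : ℕ → ℝ → ℂ := fun k _ => (S.ς k : ℂ)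

/-- The weights of the system perturbed by the polynomials `p`. -/
noncomputable def polyW {m : ℕ} (S : NikSys m) (p : ℕ → Polynomial ℂ) : ℕ → ℝ → ℂ :=
  fun k x => (S.ς k : ℂ) * (p k).eval (x : ℂ)

/-- The weights of the system perturbed by the rational functions `p/q`. -/
noncomputable def ratW {m : ℕ} (S : NikSys m) (p q : ℕ → Polynomial ℂ) : ℕ → ℝ → ℂ :=
  fun k x => (S.ς k : ℂ) * (p k).eval (x : ℂ) / (q k).eval (x : ℂ)

/-- Monic polynomials whose zeros lie in `ℂ ∖ ⋃_{k<m} Δ_k`. -/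
def GoodPolys (m : ℕ) (S : NikSys m) (p : ℕ → Polynomial ℂ) : Prop :=
  (∀ k < m, (p k).Monic) ∧
    ∀ k < m, ∀ z : ℂ, (p k).IsRoot z → ∀ i < m, z ∉ Complex.ofReal '' ihull (S.μ i)

/-- A Nikishin generator of class `N^*`: the support of `σ_k` consists of an interval
`Δ̃_k = [a_k, b_k]` on which `|σ_k'| > 0` a.e., together with a discrete set without
accumulation points in `ℝ ∖ Δ̃_k`. -/
structure NikStar (m : ℕ) extends NikSys m where
  a : ℕ → ℝ
  b : ℕ → ℝ
  hab : ∀ k < m, a k < b k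
  hsub : ∀ k < m, Set.Icc (a k) (b k) ⊆ msupport (μ k)
  hdisc : ∀ k < m, ∀ x ∉ Set.Icc (a k) (b k),
    ¬ AccPt x (Filter.principal (msupport (μ k)))
  hac : ∀ k < m,
    ∀ᵐ x ∂(MeasureTheory.volume.restrict (Set.Icc (a k) (b k))),
      0 < (μ k).rnDeriv MeasureTheory.volume x

/-- The multi-index class `ℤ₊^m(⊛; p₁,…,p_m)` (0-indexed). -/
def StarIdx (m : ℕ) (p : ℕ → Polynomial ℂ) (n : ℕ → ℕ) : Prop :=
  (∀ k, m ≤ k → n k = 0) ∧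
    ∀ j k : ℕ, j < k → k < m →
      n k + ∑ i ∈ Finset.Ioc j k, (p i).natDegree ≤ n j + 1

/-- The multi-index class `ℤ₊^m(⊛)` (0-indexed). -/
def CircIdx (m : ℕ) (n : ℕ → ℕ) : Prop :=
  (∀ k, m ≤ k → n k = 0) ∧ ∀ j k : ℕ, j < k → k < m → n k ≤ n j + 1

/-- `|n| = n₁ + ⋯ + n_m`. -/
def mnorm (m : ℕ) (n : ℕ → ℕ) : ℕ := ∑ k ∈ Finset.range m, n k

/-- Uniform convergence, on every compact subset of `U`, of the functions `f n`
to `F` as `|n| → ∞` through `Λ`. -/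
def UnifLimOn (m : ℕ) (Λ : Set ((ℕ → ℕ))) (f : (ℕ → ℕ) → ℂ → ℂ) (F : ℂ → ℂ)
    (U : Set ℂ) : Prop :=
  ∀ K : Set ℂ, K ⊆ U → IsCompact K → ∀ ε > 0, ∃ N : ℕ, ∀ n ∈ Λ, N ≤ mnorm m n →
    ∀ z ∈ K, dist (f n z) (F z) < ε

/-- `F` is analytic and nowhere vanishing on `U` and has a finite nonzero limit at `∞`. -/
def GoodLimit (F : ℂ → ℂ) (U : Set ℂ) : Prop :=
  DifferentiableOn ℂ F U ∧ (∀ z ∈ U, F z ≠ 0) ∧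
    ∃ c : ℂ, c ≠ 0 ∧ Filter.Tendsto F (Bornology.cobounded ℂ) (nhds c)

lemma measure_compl_msupport (μ : Measure ℝ) : μ (msupport μ)ᶜ = 0 := by
  refine measure_null_of_locally_null _ fun x hx => ?_
  simp only [msupport, mem_compl_iff, mem_ofPred_eq, not_forall, not_lt, nonpos_iff_eq_zero] at hx
  obtain ⟨ε, hε, h0⟩ := hx
  exact ⟨ball x ε, mem_nhdsWithin_of_mem_nhds (ball_mem_nhds x hε), h0⟩

lemma ae_mem_msupport (μ : Measure ℝ) : ∀ᵐ x ∂μ, x ∈ msupport μ :=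
  measure_compl_msupport μ

lemma msupport_subset_ihull {μ : Measure ℝ} (h : IsCompact (msupport μ)) :
    msupport μ ⊆ ihull μ := fun _ hx =>
  ⟨csInf_le h.bddBelow hx, le_csSup h.bddAbove hx⟩

lemma restrict_msupport (μ : Measure ℝ) : μ.restrict (msupport μ) = μ :=
  Measure.restrict_eq_self_of_ae_mem (ae_mem_msupport μ)

lemma integrable_of_continuousOn_msupport {μ : Measure ℝ} [IsFiniteMeasure μ]
    (h : IsCompact (msupport μ)) {g : ℝ → ℂ} (hg : ContinuousOn g (msupport μ)) :
    Integrable g μ := by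
  have := hg.integrableOn_compact (μ := μ) h
  rwa [IntegrableOn, restrict_msupport] at this

lemma continuousOn_kernel {K : Set ℝ} {g : ℝ → ℂ} (hg : ContinuousOn g K) {x : ℝ} (hx : x ∉ K) :
    ContinuousOn (fun t : ℝ => g t / ((x : ℂ) - (t : ℂ))) K := by
  refine hg.div (by fun_prop) fun t ht h => hx ?_
  rw [sub_eq_zero, Complex.ofReal_inj] at h
  rwa [h]

lemma continuous_eval_ofReal (p : Polynomial ℂ) : Continuous fun x : ℝ => p.eval (x : ℂ) :=
  p.continuous.comp Complex.continuous_ofReal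

lemma continuousOn_cauchy {μ : Measure ℝ} [IsFiniteMeasure μ]
    (h : IsCompact (msupport μ)) {g : ℝ → ℂ} (hg : ContinuousOn g (msupport μ))
    {K : Set ℝ} (hK : IsCompact K) (hd : Disjoint K (msupport μ)) :
    ContinuousOn (fun x : ℝ => ∫ t, g t / ((x : ℂ) - (t : ℂ)) ∂μ) K := by
  have hne : ∀ x ∈ K, x ∉ msupport μ := fun x hx => disjoint_left.1 hd hx
  have hc : ContinuousOn (fun z : ℝ × ℝ => g z.2 / ((z.1 : ℂ) - (z.2 : ℂ)))
      (K ×ˢ msupport μ) := by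
    refine (hg.comp continuousOn_snd fun z hz => hz.2).div (by fun_prop) fun z hz h0 => ?_
    rw [sub_eq_zero, Complex.ofReal_inj] at h0
    exact hne _ hz.1 (h0 ▸ hz.2)
  obtain ⟨C, hC⟩ := (hK.prod h).exists_bound_of_continuousOn hc
  refine continuousOn_of_dominated (bound := fun _ => C) (fun x hx => ?_) (fun x hx => ?_)
    (integrable_const C) ?_
  · exact (integrable_of_continuousOn_msupport h
      (continuousOn_kernel hg (hne x hx))).aestronglyMeasurable
  · filter_upwards [ae_mem_msupport μ] with t ht using hC (x, t) ⟨hx, ht⟩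
  · filter_upwards [ae_mem_msupport μ] with t ht
    exact hc.comp (by fun_prop : ContinuousOn (fun x : ℝ => (x, t)) K) fun x hx => ⟨hx, ht⟩

/-- Moving a polynomial of degree at most `d` inside a Cauchy transform costs a polynomial
of degree less than `d`. -/
lemma exists_eval_mul_cauchy {μ : Measure ℝ} [IsFiniteMeasure μ]
    (h : IsCompact (msupport μ)) {g : ℝ → ℂ} (hg : ContinuousOn g (msupport μ)) (d : ℕ) :
    ∀ p : Polynomial ℂ, p.natDegree ≤ d → ∃ R : Polynomial ℂ, R.degree < d ∧
      ∀ x : ℝ, x ∉ msupport μ →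
        p.eval (x : ℂ) * ∫ t, g t / ((x : ℂ) - (t : ℂ)) ∂μ =
          (∫ t, p.eval (t : ℂ) * g t / ((x : ℂ) - (t : ℂ)) ∂μ) + R.eval (x : ℂ) := by
  induction d with
  | zero =>
    intro p hp
    refine ⟨0, by simp, fun x _ => ?_⟩
    rw [eq_C_of_natDegree_le_zero hp]
    simp [mul_div_assoc, integral_const_mul]
  | succ d ih =>
    intro p hp
    obtain ⟨R, hR, hRx⟩ := ih p.divX (by rw [natDegree_divX_eq_natDegree_tsub_one]; omega)
    refine ⟨C (∫ t : ℝ, p.divX.eval (t : ℂ) * g t ∂μ) + X * R, ?_, fun x hx => ?_⟩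
    · refine (degree_add_le _ _).trans_lt (max_lt ?_ ?_)
      · exact degree_C_le.trans_lt (by exact_mod_cast d.succ_pos)
      · rcases eq_or_ne R 0 with rfl | h0
        · simp
        · rw [← natDegree_lt_iff_degree_lt (mul_ne_zero X_ne_zero h0), natDegree_X_mul h0]
          rw [← natDegree_lt_iff_degree_lt h0] at hR
          omega
    · have hp' : ∀ y : ℂ, p.eval y = y * p.divX.eval y + p.coeff 0 := fun y => by
        nth_rewrite 1 [← divX_mul_X_add p]
        simp only [eval_add, eval_mul, eval_X, eval_C, mul_comm]
      have hgp : ContinuousOn (fun t : ℝ => p.divX.eval (t : ℂ) * g t) (msupport μ) :=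
        (continuous_eval_ofReal _).continuousOn.mul hg
      have i1 := integrable_of_continuousOn_msupport h (continuousOn_kernel hg hx)
      have i2 := integrable_of_continuousOn_msupport h (continuousOn_kernel hgp hx)
      have i3 := integrable_of_continuousOn_msupport h hgp
      have key : ∫ t : ℝ, p.eval (t : ℂ) * g t / ((x : ℂ) - (t : ℂ)) ∂μ =
          ∫ t : ℝ, ((x : ℂ) * (p.divX.eval (t : ℂ) * g t / ((x : ℂ) - (t : ℂ)))
            - p.divX.eval (t : ℂ) * g t) + p.coeff 0 * (g t / ((x : ℂ) - (t : ℂ))) ∂μ := by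
        refine integral_congr_ae ?_
        filter_upwards [ae_mem_msupport μ] with t ht
        have hne : (x : ℂ) - (t : ℂ) ≠ 0 := fun h0 => hx (by
          rw [sub_eq_zero, Complex.ofReal_inj] at h0
          rwa [h0])
        rw [hp' t]
        field_simp
        ring
      have i23 : Integrable (fun t : ℝ => (x : ℂ) *
          (p.divX.eval (t : ℂ) * g t / ((x : ℂ) - (t : ℂ))) - p.divX.eval (t : ℂ) * g t) μ :=
        (i2.const_mul _).sub i3
      rw [key, integral_add i23 (i1.const_mul _), integral_sub (i2.const_mul _) i3, integral_const_mul, integral_const_mul, hp' x, add_mul,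
        mul_assoc, hRx x hx]
      simp only [eval_add, eval_C, eval_mul, eval_X]
      ring

section NikSys

variable {m : ℕ} (S : NikSys m)

lemma NikSys.disjoint_msupport {a : ℕ} (ha : a + 1 < m) :
    Disjoint (msupport (S.μ a)) (msupport (S.μ (a + 1))) :=
  (disjoint_iff_inter_eq_empty.2 (S.hdisj a ha)).mono
    (msupport_subset_ihull (S.hcpt a (by omega))) (msupport_subset_ihull (S.hcpt _ ha))

lemma NikSys.continuousOn_nikD {w : ℕ → ℝ → ℂ} (hw : ∀ k, Continuous (w k)) (r : ℕ) :
    ∀ a, a + r < m → ContinuousOn (nikD S.μ w a r) (msupport (S.μ a)) := by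
  induction r with
  | zero => exact fun a _ => (hw a).continuousOn
  | succ r ih =>
    intro a ha
    have := S.hfin (a + 1) (by omega)
    exact (hw a).continuousOn.mul (continuousOn_cauchy (S.hcpt _ (by omega))
      (ih (a + 1) (by omega)) (S.hcpt a (by omega)) (S.disjoint_msupport (by omega)))

lemma NikSys.continuous_w (k : ℕ) : Continuous (S.w k) := continuous_const

lemma continuous_polyW (p : ℕ → Polynomial ℂ) (k : ℕ) : Continuous (polyW S p k) :=
  continuous_const.mul (continuous_eval_ofReal _)

/-- The densities of the unperturbed system, multiplied by the product of the perturbing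
polynomials, are polynomial combinations of the densities of the perturbed system. -/
lemma NikSys.exists_prod_mul_nikD (p : ℕ → Polynomial ℂ) (r : ℕ) :
    ∀ a, a + r < m → ∃ c : ℕ → Polynomial ℂ, c r = 1 ∧
      (∀ j < r, (c j).degree < (∑ i ∈ Finset.Ioc (a + j) (a + r), (p i).natDegree : ℕ)) ∧
      ∀ x ∈ msupport (S.μ a),
        (∏ i ∈ Finset.Icc a (a + r), p i).eval (x : ℂ) * nikD S.μ S.w a r x =
          ∑ j ∈ Finset.range (r + 1), (c j).eval (x : ℂ) * nikD S.μ (polyW S p) a j x := by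
  induction r with
  | zero =>
    refine fun a _ => ⟨fun _ => 1, rfl, by simp, fun x _ => ?_⟩
    simp [nikD, NikSys.w, polyW, mul_comm]
  | succ r ih =>
    intro a ha
    obtain ⟨c, hc, hdeg, hid⟩ := ih (a + 1) (by omega)
    have := S.hfin (a + 1) (by omega)
    have hcpt := S.hcpt (a + 1) (by omega)
    have hD := S.continuousOn_nikD S.continuous_w r (a + 1) (by omega)
    set N := ∑ i ∈ Finset.Ioc a (a + (r + 1)), (p i).natDegree
    set P := ∏ i ∈ Finset.Icc (a + 1) (a + 1 + r), p i with hP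
    have hPN : P.natDegree ≤ N := by
      refine (natDegree_prod_le _ _).trans_eq (Finset.sum_congr ?_ fun _ _ => rfl)
      ext i
      simp only [Finset.mem_Icc, Finset.mem_Ioc]
      omega
    obtain ⟨R, hR, hRx⟩ := exists_eval_mul_cauchy hcpt hD N P hPN
    have hcN : ∀ j ∈ Finset.range (r + 1), (c j).natDegree ≤ N := by
      intro j hj
      rcases (Nat.lt_succ_iff.1 (Finset.mem_range.1 hj)).eq_or_lt with rfl | hj
      · simp [hc]
      · refine (natDegree_le_of_degree_le (hdeg j hj).le).trans
          (Finset.sum_le_sum_of_subset fun i => ?_)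
        simp only [Finset.mem_Ioc]
        omega
    have hDt : ∀ j ∈ Finset.range (r + 1),
        ContinuousOn (nikD S.μ (polyW S p) (a + 1) j) (msupport (S.μ (a + 1))) := fun j hj =>
      S.continuousOn_nikD (continuous_polyW S p) j (a + 1) (by
        have := Finset.mem_range.1 hj
        omega)
    have hT : ∀ j, ∃ T : Polynomial ℂ, j ∈ Finset.range (r + 1) → T.degree < N ∧
        ∀ x : ℝ, x ∉ msupport (S.μ (a + 1)) →
          (c j).eval (x : ℂ) *
              ∫ t, nikD S.μ (polyW S p) (a + 1) j t / ((x : ℂ) - (t : ℂ)) ∂S.μ (a + 1) =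
            (∫ t, (c j).eval (t : ℂ) * nikD S.μ (polyW S p) (a + 1) j t /
              ((x : ℂ) - (t : ℂ)) ∂S.μ (a + 1)) + T.eval (x : ℂ) := fun j => by
      by_cases hj : j ∈ Finset.range (r + 1)
      · obtain ⟨T, hT⟩ := exists_eval_mul_cauchy hcpt (hDt j hj) N (c j) (hcN j hj)
        exact ⟨T, fun _ => hT⟩
      · exact ⟨0, fun h => absurd h hj⟩
    choose T hT using hT
    obtain ⟨c', hc0, hcs⟩ : ∃ c' : ℕ → Polynomial ℂ,
        c' 0 = R - ∑ j ∈ Finset.range (r + 1), T j ∧ ∀ j, c' (j + 1) = c j :=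
      ⟨fun j => Nat.casesOn j (R - ∑ j ∈ Finset.range (r + 1), T j) c, rfl, fun _ => rfl⟩
    refine ⟨c', (hcs r).trans hc, ?_, fun x hx => ?_⟩
    · rintro (_ | j) hj
      · rw [add_zero, hc0]
        rw [← mem_degreeLT] at hR ⊢
        exact sub_mem hR (sum_mem fun j hj => mem_degreeLT.2 (hT j hj).1)
      · have := hdeg j (by omega)
        rw [hcs]
        rwa [show a + 1 + j = a + (j + 1) by ring, show a + 1 + r = a + (r + 1) by ring] at this
    · have hx' : x ∉ msupport (S.μ (a + 1)) :=
        disjoint_left.1 (S.disjoint_msupport (by omega)) hx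
      have hprod : ∏ i ∈ Finset.Icc a (a + (r + 1)), p i = p a * P := by
        rw [← Finset.insert_Icc_add_one_left_eq_Icc (by omega), Finset.prod_insert (by simp), hP,
          show a + 1 + r = a + (r + 1) by ring]
      have hsum : ∫ t, P.eval (t : ℂ) * nikD S.μ S.w (a + 1) r t / ((x : ℂ) - (t : ℂ))
            ∂S.μ (a + 1) =
          ∑ j ∈ Finset.range (r + 1), ∫ t, (c j).eval (t : ℂ) *
            nikD S.μ (polyW S p) (a + 1) j t / ((x : ℂ) - (t : ℂ)) ∂S.μ (a + 1) := by
        have hi : ∀ j ∈ Finset.range (r + 1), Integrable (fun t : ℝ => (c j).eval (t : ℂ) *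
            nikD S.μ (polyW S p) (a + 1) j t / ((x : ℂ) - (t : ℂ))) (S.μ (a + 1)) := fun j hj =>
          integrable_of_continuousOn_msupport hcpt (continuousOn_kernel
            ((continuous_eval_ofReal (c j)).continuousOn.mul (hDt j hj)) hx')
        rw [← integral_finsetSum _ hi]
        refine integral_congr_ae ?_
        filter_upwards [ae_mem_msupport _] with t ht
        rw [hid t ht, Finset.sum_div]
      have hsum' : ∑ j ∈ Finset.range (r + 1), (c j).eval (x : ℂ) *
              ∫ t, nikD S.μ (polyW S p) (a + 1) j t / ((x : ℂ) - (t : ℂ)) ∂S.μ (a + 1) =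
          (∑ j ∈ Finset.range (r + 1), ∫ t, (c j).eval (t : ℂ) *
            nikD S.μ (polyW S p) (a + 1) j t / ((x : ℂ) - (t : ℂ)) ∂S.μ (a + 1)) +
          ∑ j ∈ Finset.range (r + 1), (T j).eval (x : ℂ) := by
        rw [← Finset.sum_add_distrib]
        exact Finset.sum_congr rfl fun j hj => (hT j hj).2 x hx'
      rw [Finset.sum_range_succ', hprod]
      simp only [nikD, hc0, hcs, eval_mul, eval_sub, eval_finsetSum]
      have hL : ∀ I : ℂ, eval (x : ℂ) (p a) * eval (x : ℂ) P * (S.w a x * I) =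
          polyW S p a x * (eval (x : ℂ) P * I) := fun I => by
        simp only [NikSys.w, polyW]
        ring
      simp only [mul_left_comm _ (polyW S p a x)]
      rw [hL, hRx x hx', hsum, ← Finset.mul_sum, hsum']
      ring

lemma NikSys.integrable_mul_nikD {w : ℕ → ℝ → ℂ} (hw : ∀ k, Continuous (w k)) {k : ℕ}
    (hk : k < m) {f : ℝ → ℂ} (hf : Continuous f) :
    Integrable (fun x => f x * nikD S.μ w 0 k x) (S.μ 0) := by
  have := S.hfin 0 (by omega)
  exact integrable_of_continuousOn_msupport (S.hcpt 0 (by omega))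
    (hf.continuousOn.mul (S.continuousOn_nikD hw k 0 (by omega)))

lemma OrthRel.nikInt_eval_mul {w : ℕ → ℝ → ℂ} (hw : ∀ k, Continuous (w k)) {n : ℕ → ℕ}
    {Q : Polynomial ℂ} (h : OrthRel S.μ w m n Q) {k : ℕ} (hk : k < m) {R : Polynomial ℂ}
    (hR : R.degree < n k) :
    nikInt S.μ w k (fun x => R.eval (x : ℂ) * Q.eval (x : ℂ)) = 0 := by
  have hE : ∀ x : ℝ, R.eval (x : ℂ) * Q.eval (x : ℂ) * nikD S.μ w 0 k x =
      ∑ i ∈ R.support, R.coeff i * ((x : ℂ) ^ i * Q.eval (x : ℂ) * nikD S.μ w 0 k x) := by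
    intro x
    rw [eval_eq_sum, sum_def, Finset.sum_mul, Finset.sum_mul]
    exact Finset.sum_congr rfl fun i _ => by ring
  simp only [nikInt, hE]
  have hc : ∀ i : ℕ, Continuous fun x : ℝ => (x : ℂ) ^ i * Q.eval (x : ℂ) := fun i =>
    (Complex.continuous_ofReal.pow i).mul (continuous_eval_ofReal Q)
  rw [integral_finsetSum _ fun i _ => (S.integrable_mul_nikD hw hk (hc i)).const_mul _]
  refine Finset.sum_eq_zero fun i hi => ?_
  have hi' : i < n k := by
    exact_mod_cast (le_degree_of_mem_supp i hi).trans_lt hR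
  have h0 := h k hk i hi'
  rw [nikInt] at h0
  rw [integral_const_mul, h0, mul_zero]

end NikSys

/-- If `n ∈ ℤ₊^m(⊛; p₁,…,p_m)` then for each `k` the perturbed multiple
orthogonal polynomial `Q̃_n` satisfies
`∫ x^ν Q̃_n(x) (p₁⋯p_m)(x) ds_k(x) = 0` for `ν = 0, …, n_k - deg(p_{k+1}⋯p_m) - 1`. -/
theorem perturbed_MOP_orthogonality_full_product
    (m : ℕ) (hm : 0 < m) (S : NikSys m) (p : ℕ → Polynomial ℂ) (hp : GoodPolys m S p)
    (n : ℕ → ℕ) (hn : StarIdx m p n)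
    (Qt : Polynomial ℂ) (hQt : IsLeastMOP S.μ (polyW S p) m n Qt) :
    ∀ k < m, ∀ ν : ℕ, ν + ∑ i ∈ Finset.Ioc k (m - 1), (p i).natDegree < n k →
      nikInt S.μ S.w k
        (fun x => (x : ℂ) ^ ν * Qt.eval (x : ℂ) *
          (∏ i ∈ Finset.range m, p i).eval (x : ℂ)) = 0 := by
  intro k hk ν hν
  obtain ⟨c, hc, hdeg, hid⟩ := S.exists_prod_mul_nikD p k 0 (by omega)
  simp only [zero_add] at hdeg hid
  set P := ∏ i ∈ Finset.Ioc k (m - 1), p i with hP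
  have hPdeg : P.natDegree ≤ ∑ i ∈ Finset.Ioc k (m - 1), (p i).natDegree := natDegree_prod_le _ _
  have hprod : ∏ i ∈ Finset.range m, p i = P * ∏ i ∈ Finset.Icc 0 k, p i := by
    rw [hP, mul_comm, ← Finset.prod_union]
    · refine Finset.prod_congr ?_ fun _ _ => rfl
      ext i
      simp only [Finset.mem_range, Finset.mem_union, Finset.mem_Icc, Finset.mem_Ioc]
      omega
    · rw [Finset.disjoint_left]
      intro i
      simp only [Finset.mem_Icc, Finset.mem_Ioc]
      omega
  have hjm : ∀ j ∈ Finset.range (k + 1), j < m := fun j hj => by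
    have := Finset.mem_range.1 hj
    omega
  have hE : nikInt S.μ S.w k (fun x => (x : ℂ) ^ ν * Qt.eval (x : ℂ) *
        (∏ i ∈ Finset.range m, p i).eval (x : ℂ)) =
      ∑ j ∈ Finset.range (k + 1), nikInt S.μ (polyW S p) j
        (fun x => (X ^ ν * P * c j).eval (x : ℂ) * Qt.eval (x : ℂ)) := by
    simp only [nikInt]
    have hi : ∀ j ∈ Finset.range (k + 1), Integrable (fun x : ℝ =>
        (X ^ ν * P * c j).eval (x : ℂ) * Qt.eval (x : ℂ) * nikD S.μ (polyW S p) 0 j x) (S.μ 0) :=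
      fun j hj => S.integrable_mul_nikD (continuous_polyW S p) (hjm j hj)
        ((continuous_eval_ofReal _).mul (continuous_eval_ofReal _))
    rw [← integral_finsetSum _ hi]
    refine integral_congr_ae ?_
    filter_upwards [ae_mem_msupport _] with x hx
    calc _ = (x : ℂ) ^ ν * Qt.eval (x : ℂ) * P.eval (x : ℂ) *
          ((∏ i ∈ Finset.Icc 0 k, p i).eval (x : ℂ) * nikD S.μ S.w 0 k x) := by
          rw [hprod, eval_mul]
          ring
      _ = _ := by
          rw [hid x hx, Finset.mul_sum]
          refine Finset.sum_congr rfl fun j _ => ?_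
          simp only [eval_mul, eval_pow, eval_X]
          ring
  rw [hE]
  refine Finset.sum_eq_zero fun j hj =>
    hQt.2.1.nikInt_eval_mul S (continuous_polyW S p) (hjm j hj) ?_
  have hXP : (X ^ ν * P).natDegree ≤ ν + P.natDegree :=
    natDegree_mul_le.trans (by rw [natDegree_X_pow])
  rcases (Nat.lt_succ_iff.1 (Finset.mem_range.1 hj)).eq_or_lt with rfl | hjk
  · rw [hc, mul_one]
    refine degree_le_natDegree.trans_lt ?_
    exact_mod_cast (show (X ^ ν * P).natDegree < n j by omega)
  · rcases eq_or_ne (c j) 0 with h0 | h0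
    · simp [h0]
    · have h1 := hdeg j hjk
      rw [← natDegree_lt_iff_degree_lt h0] at h1
      have h2 := hn.2 j k hjk hk
      have h3 : (X ^ ν * P * c j).natDegree ≤ _ := natDegree_mul_le
      refine degree_le_natDegree.trans_lt ?_
      exact_mod_cast (show (X ^ ν * P * c j).natDegree < n j by omega)
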